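/- In the linear model (p_k = k/m for all 0 ≤ k ≤ m) with X_0 > 0 and Y_0 > 0, the distribution of the almost sure limit a = lim_{n→∞} a_n has no atoms: for every r ∈ [0,1], P(a = r) = 0. -/

import Mathlib

open MeasureTheory ProbabilityTheory Filter Set

noncomputable section

/-- The polynomial `P(z) = (1/2) ∑_{k=0}^m C(m,k) z^k (1-z)^{m-k} (p_k - k/m)`. -/
def polyP (m : ℕ) (p : ℕ → ℝ) (z : ℝ) : ℝ :=
  (1 / 2) * ∑ k ∈ Finset.range (m + 1),
    (m.choose k : ℝ) * z ^ k * (1 - z) ^ (m - k) * (p k - (k : ℝ) / m)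

/-- The zero set `Z_P = {z ∈ [0,1] : P(z) = 0}`. -/
def zeroSetP (m : ℕ) (p : ℕ → ℝ) : Set ℝ :=
  {z ∈ Set.Icc (0 : ℝ) 1 | polyP m p z = 0}

/-- The two-type preferential attachment process with `m` edges per new node and type
adoption parameters `p 0, …, p m`, defined on a probability space `(Ω, μ)` with filtration
`F`.  `A n` is the number of red nodes and `X n` the sum of the degrees of red nodes at time
`n`; the transition probabilities given `F n` are those of the model: a number `k` of red
neighbours is drawn from the `Binomial(m, x_n)` distribution, and then the new node is red
with probability `p k` (adding `1` to the red nodes and `k + m` to the red degrees) and blue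
with probability `1 - p k` (adding `k` to the red degrees). -/
structure PAProcess (Ω : Type) [MeasurableSpace Ω] where
  μ : Measure Ω
  isProb : IsProbabilityMeasure μ
  m : ℕ
  hm : 1 ≤ m
  p : ℕ → ℝ
  hp : ∀ k ≤ m, p k ∈ Set.Icc (0 : ℝ) 1
  A : ℕ → Ω → ℕ
  X : ℕ → Ω → ℕ
  F : Filtration ℕ ‹MeasurableSpace Ω›
  A0 : ℕ
  B0 : ℕ
  X0 : ℕ
  Y0 : ℕ
  hA0 : ∀ ω, A 0 ω = A0
  hX0 : ∀ ω, X 0 ω = X0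
  adaptedA : ∀ n, Measurable[F n] (A n)
  adaptedX : ∀ n, Measurable[F n] (X n)
  hXle : ∀ n ω, X n ω ≤ X0 + Y0 + 2 * m * n
  step_red : ∀ n, ∀ k ≤ m,
    μ[Set.indicator {ω | A (n + 1) ω = A n ω + 1 ∧ X (n + 1) ω = X n ω + k + m}
        (fun _ => (1 : ℝ)) | F n]
      =ᵐ[μ] fun ω => (m.choose k : ℝ) *
        ((X n ω : ℝ) / ((X0 : ℝ) + Y0 + 2 * m * n)) ^ k *
        (1 - (X n ω : ℝ) / ((X0 : ℝ) + Y0 + 2 * m * n)) ^ (m - k) * p k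
  step_blue : ∀ n, ∀ k ≤ m,
    μ[Set.indicator {ω | A (n + 1) ω = A n ω ∧ X (n + 1) ω = X n ω + k}
        (fun _ => (1 : ℝ)) | F n]
      =ᵐ[μ] fun ω => (m.choose k : ℝ) *
        ((X n ω : ℝ) / ((X0 : ℝ) + Y0 + 2 * m * n)) ^ k *
        (1 - (X n ω : ℝ) / ((X0 : ℝ) + Y0 + 2 * m * n)) ^ (m - k) * (1 - p k)

namespace PAProcess

variable {Ω : Type} [MeasurableSpace Ω] (P : PAProcess Ω)

/-- Total degree `S_n = S_0 + 2mn`. -/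
def S (n : ℕ) : ℕ := P.X0 + P.Y0 + 2 * P.m * n

/-- Normalized red degree `x_n = X_n / S_n`. -/
def x (n : ℕ) (ω : Ω) : ℝ := (P.X n ω : ℝ) / (P.S n : ℝ)

/-- Normalized red node count `a_n = A_n / (A_0 + B_0 + n)`. -/
def a (n : ℕ) (ω : Ω) : ℝ := (P.A n ω : ℝ) / ((P.A0 : ℝ) + P.B0 + n)

/-- The polynomial `P` of the process. -/
def poly : ℝ → ℝ := polyP P.m P.p

/-- The zero set `Z_P` of the process. -/
def Zp : Set ℝ := zeroSetP P.m P.p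

end PAProcess


lemma bern0 (m : ℕ) (x : ℝ) :
    ∑ k ∈ Finset.range (m + 1), (m.choose k : ℝ) * x ^ k * (1 - x) ^ (m - k) = 1 := by
  have h := congrArg (Polynomial.eval x) (bernsteinPolynomial.sum ℝ m)
  simpa [Polynomial.eval_finsetSum, bernsteinPolynomial] using h

lemma bern1 (m : ℕ) (x : ℝ) :
    ∑ k ∈ Finset.range (m + 1), (m.choose k : ℝ) * x ^ k * (1 - x) ^ (m - k) * k = m * x := by
  have h := congrArg (Polynomial.eval x) (bernsteinPolynomial.sum_smul ℝ m)
  simp [Polynomial.eval_finsetSum, bernsteinPolynomial] at h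
  rw [← h]
  exact Finset.sum_congr rfl fun k _ => by ring

lemma bern2 (m : ℕ) (x : ℝ) :
    ∑ k ∈ Finset.range (m + 1), (m.choose k : ℝ) * x ^ k * (1 - x) ^ (m - k) * (k : ℝ) ^ 2
      = m * x * (1 - x) + (m * x) ^ 2 := by
  have h := congrArg (Polynomial.eval x) (bernsteinPolynomial.variance ℝ m)
  simp [Polynomial.eval_finsetSum, bernsteinPolynomial] at h
  have h0 := bern0 m x
  have h1 := bern1 m x
  have : ∑ k ∈ Finset.range (m + 1),
        (m * x - k) ^ 2 * ((m.choose k : ℝ) * x ^ k * (1 - x) ^ (m - k))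
      = (m * x) ^ 2 * ∑ k ∈ Finset.range (m + 1), (m.choose k : ℝ) * x ^ k * (1 - x) ^ (m - k)
        - 2 * (m * x) * ∑ k ∈ Finset.range (m + 1),
            (m.choose k : ℝ) * x ^ k * (1 - x) ^ (m - k) * k
        + ∑ k ∈ Finset.range (m + 1),
            (m.choose k : ℝ) * x ^ k * (1 - x) ^ (m - k) * (k : ℝ) ^ 2 := by
    rw [Finset.mul_sum, Finset.mul_sum, ← Finset.sum_sub_distrib, ← Finset.sum_add_distrib]
    exact Finset.sum_congr rfl fun k _ => by ring
  rw [h0, h1, h] at this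
  linarith

namespace PAProcess

variable {Ω : Type} [MeasurableSpace Ω] (P : PAProcess Ω)

def Good (n : ℕ) (w : Ω → ℝ) : Prop := Measurable[P.F n] w ∧ ∃ C, ∀ ω, |w ω| ≤ C

def Rd (n k : ℕ) : Set Ω :=
  {ω | P.A (n + 1) ω = P.A n ω + 1 ∧ P.X (n + 1) ω = P.X n ω + k + P.m}

def Bl (n k : ℕ) : Set Ω :=
  {ω | P.A (n + 1) ω = P.A n ω ∧ P.X (n + 1) ω = P.X n ω + k}

def bb (n k : ℕ) (ω : Ω) : ℝ :=
  (P.m.choose k : ℝ) * P.x n ω ^ k * (1 - P.x n ω) ^ (P.m - k)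

lemma mA (n : ℕ) : Measurable (P.A n) := (P.adaptedA n).mono (P.F.le n) le_rfl
lemma mX (n : ℕ) : Measurable (P.X n) := (P.adaptedX n).mono (P.F.le n) le_rfl

lemma mRd (n k : ℕ) : MeasurableSet (P.Rd n k) := by
  apply MeasurableSet.inter
  · exact measurableSet_eq_fun (P.mA _) ((P.mA _).add_const 1)
  · exact measurableSet_eq_fun (P.mX _) (((P.mX _).add_const k).add_const P.m)

lemma mBl (n k : ℕ) : MeasurableSet (P.Bl n k) := by
  apply MeasurableSet.inter
  · exact measurableSet_eq_fun (P.mA _) (P.mA _)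
  · exact measurableSet_eq_fun (P.mX _) ((P.mX _).add_const k)

variable {P}

lemma Good.meas {n : ℕ} {w : Ω → ℝ} (h : P.Good n w) : Measurable w :=
  h.1.mono (P.F.le n) le_rfl

lemma Good.integrable {n : ℕ} {w : Ω → ℝ} (h : P.Good n w) : Integrable w P.μ := by
  have := P.isProb
  obtain ⟨C, hC⟩ := h.2
  exact Integrable.of_bound h.meas.aestronglyMeasurable C (ae_of_all _ hC)

lemma Good.mono {n k : ℕ} (hnk : n ≤ k) {w : Ω → ℝ} (h : P.Good n w) : P.Good k w :=
  ⟨h.1.mono (P.F.mono hnk) le_rfl, h.2⟩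

lemma Good.mul {n : ℕ} {w v : Ω → ℝ} (h : P.Good n w) (h' : P.Good n v) :
    P.Good n (fun ω => w ω * v ω) := by
  obtain ⟨C, hC⟩ := h.2
  obtain ⟨D, hD⟩ := h'.2
  refine ⟨h.1.mul h'.1, C * D, fun ω => ?_⟩
  rw [abs_mul]
  exact mul_le_mul (hC ω) (hD ω) (abs_nonneg _) ((abs_nonneg _).trans (hC ω))

lemma Good.add {n : ℕ} {w v : Ω → ℝ} (h : P.Good n w) (h' : P.Good n v) :
    P.Good n (fun ω => w ω + v ω) := by
  obtain ⟨C, hC⟩ := h.2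
  obtain ⟨D, hD⟩ := h'.2
  exact ⟨h.1.add h'.1, C + D, fun ω => (abs_add_le _ _).trans (add_le_add (hC ω) (hD ω))⟩

lemma good_const (n : ℕ) (c : ℝ) : P.Good n (fun _ => c) :=
  ⟨measurable_const, |c|, fun _ => le_rfl⟩

lemma good_ind {n : ℕ} {E : Set Ω} (hE : MeasurableSet[P.F n] E) :
    P.Good n (E.indicator fun _ => (1 : ℝ)) := by
  refine ⟨measurable_const.indicator hE, 1, fun ω => ?_⟩
  by_cases h : ω ∈ E <;> simp [h]

variable (P)

lemma S_pos (hX0 : 0 < P.X0) (n : ℕ) : (1 : ℝ) ≤ P.S n := by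
  have : 1 ≤ P.S n := by unfold S; omega
  exact_mod_cast this

lemma S_succ (n : ℕ) : (P.S (n + 1) : ℝ) = P.S n + 2 * P.m := by
  unfold S; push_cast; ring

lemma x_mem (n : ℕ) (ω : Ω) : P.x n ω ∈ Set.Icc (0 : ℝ) 1 := by
  unfold x
  refine ⟨by positivity, div_le_one_of_le₀ ?_ (by positivity)⟩
  exact_mod_cast P.hXle n ω

lemma x_meas (n : ℕ) : Measurable[P.F n] (P.x n) := by
  have : Measurable (fun k : ℕ => (k : ℝ) / (P.S n : ℝ)) := measurable_from_top
  exact this.comp (P.adaptedX n)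

lemma good_x (n : ℕ) {f : ℝ → ℝ} (hf : Continuous f) : P.Good n (fun ω => f (P.x n ω)) := by
  obtain ⟨C, hC⟩ := isCompact_Icc.exists_bound_of_continuousOn (s := Set.Icc (0 : ℝ) 1)
    hf.continuousOn
  exact ⟨hf.measurable.comp (P.x_meas n), C, fun ω => hC _ (P.x_mem n ω)⟩

lemma x_eq (n : ℕ) (ω : Ω) :
    (P.X n ω : ℝ) / ((P.X0 : ℝ) + P.Y0 + 2 * P.m * n) = P.x n ω := by
  unfold x S; push_cast; rfl

lemma int_ind {n : ℕ} {w : Ω → ℝ} (hw : P.Good n w) {E : Set Ω} (hE : MeasurableSet E)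
    {h : Ω → ℝ} (hh : P.μ[E.indicator (fun _ => (1 : ℝ)) | P.F n] =ᵐ[P.μ] h) :
    ∫ ω, w ω * E.indicator (fun _ => (1 : ℝ)) ω ∂P.μ = ∫ ω, w ω * h ω ∂P.μ := by
  have := P.isProb
  obtain ⟨C, hC⟩ := hw.2
  have hi : Integrable (E.indicator (fun _ => (1 : ℝ))) P.μ :=
    (integrable_const (1 : ℝ)).indicator hE
  have h1 := condExp_stronglyMeasurable_mul_of_bound (μ := P.μ) (P.F.le n)
    hw.1.stronglyMeasurable hi C (ae_of_all _ hC)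
  have h2 := integral_condExp (μ := P.μ) (P.F.le n) (f := w * E.indicator (fun _ => (1 : ℝ)))
  change ∫ ω, (w * E.indicator (fun _ => (1 : ℝ))) ω ∂P.μ = _
  rw [← h2]
  apply integral_congr_ae
  filter_upwards [h1, hh] with ω a b
  rw [a, Pi.mul_apply, b]

lemma int_red {n : ℕ} {w : Ω → ℝ} (hw : P.Good n w) {k : ℕ} (hk : k ≤ P.m) :
    ∫ ω, w ω * (P.Rd n k).indicator (fun _ => (1 : ℝ)) ω ∂P.μ
      = ∫ ω, w ω * (P.bb n k ω * P.p k) ∂P.μ := by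
  refine P.int_ind hw (P.mRd n k) ((P.step_red n k hk).trans (ae_of_all _ fun ω => ?_))
  simp only [x_eq, bb]

lemma int_blue {n : ℕ} {w : Ω → ℝ} (hw : P.Good n w) {k : ℕ} (hk : k ≤ P.m) :
    ∫ ω, w ω * (P.Bl n k).indicator (fun _ => (1 : ℝ)) ω ∂P.μ
      = ∫ ω, w ω * (P.bb n k ω * (1 - P.p k)) ∂P.μ := by
  refine P.int_ind hw (P.mBl n k) ((P.step_blue n k hk).trans (ae_of_all _ fun ω => ?_))
  simp only [x_eq, bb]

lemma good_bb (n k : ℕ) : P.Good n (P.bb n k) :=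
  P.good_x n (f := fun x => (P.m.choose k : ℝ) * x ^ k * (1 - x) ^ (P.m - k)) (by fun_prop)

lemma cover (n : ℕ) : ∀ᵐ ω ∂P.μ, ∃ k ≤ P.m, ω ∈ P.Rd n k ∨ ω ∈ P.Bl n k := by
  have := P.isProb
  let f : Ω → ℝ := fun ω => ∑ k ∈ Finset.range (P.m + 1),
    ((P.Rd n k).indicator (fun _ => (1 : ℝ)) ω + (P.Bl n k).indicator (fun _ => (1 : ℝ)) ω)
  have hiR : ∀ k, Integrable ((P.Rd n k).indicator (fun _ => (1 : ℝ))) P.μ := fun k =>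
    (integrable_const (1 : ℝ)).indicator (P.mRd n k)
  have hiB : ∀ k, Integrable ((P.Bl n k).indicator (fun _ => (1 : ℝ))) P.μ := fun k =>
    (integrable_const (1 : ℝ)).indicator (P.mBl n k)
  have hfi : Integrable f P.μ := integrable_finsetSum _ fun k _ => (hiR k).add (hiB k)
  have hint : ∫ ω, f ω ∂P.μ = 1 := by
    have : ∀ k ∈ Finset.range (P.m + 1),
        ∫ ω, ((P.Rd n k).indicator (fun _ => (1 : ℝ)) ω
          + (P.Bl n k).indicator (fun _ => (1 : ℝ)) ω) ∂P.μ = ∫ ω, P.bb n k ω ∂P.μ := by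
      intro k hk
      have hk : k ≤ P.m := by simpa [Nat.lt_succ_iff] using hk
      have h1 := P.int_red (good_const n 1) hk
      have h2 := P.int_blue (good_const n 1) hk
      simp only [one_mul] at h1 h2
      rw [integral_add (hiR k) (hiB k), h1, h2, ← integral_add]
      · congr 1; ext ω; ring
      · exact (P.good_bb n k).integrable.mul_const _
      · exact (P.good_bb n k).integrable.mul_const _
    change ∫ ω, ∑ k ∈ Finset.range (P.m + 1),
      ((P.Rd n k).indicator (fun _ => (1 : ℝ)) ω
        + (P.Bl n k).indicator (fun _ => (1 : ℝ)) ω) ∂P.μ = 1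
    rw [integral_finsetSum, Finset.sum_congr rfl this,
      ← integral_finsetSum _ fun k _ => (P.good_bb n k).integrable]
    · simp only [bb, bern0]
      simp
    · exact fun k _ => (hiR k).add (hiB k)
  have hle : ∀ ω, f ω ≤ 1 := by
    intro ω
    by_cases h : ∃ k ≤ P.m, ω ∈ P.Rd n k ∨ ω ∈ P.Bl n k
    · obtain ⟨k, hk, h⟩ := h
      have : f ω ≤ ∑ j ∈ Finset.range (P.m + 1), if j = k then (1 : ℝ) else 0 := by
        apply Finset.sum_le_sum
        intro j _
        by_cases h1 : ω ∈ P.Rd n j <;> by_cases h2 : ω ∈ P.Bl n j <;> by_cases h3 : j = k <;>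
          first
          | (exfalso; simp only [Rd, Bl, Set.mem_ofPred_eq] at h h1 h2; omega)
          | (subst h3; simp [h1, h2]; done)
          | simp [h1, h2, h3]
      refine this.trans ?_
      simp [hk]
    · push Not at h
      have : f ω = 0 := Finset.sum_eq_zero fun k hk => by
        have hk : k ≤ P.m := by simpa [Nat.lt_succ_iff] using hk
        simp [h k hk]
      linarith
  have h0 : ∫ ω, (1 - f ω) ∂P.μ = 0 := by
    rw [integral_sub (integrable_const _) hfi, hint]; simp
  have h1 := (integral_eq_zero_iff_of_nonneg (fun ω => sub_nonneg.2 (hle ω))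
    ((integrable_const _).sub hfi)).1 h0
  filter_upwards [h1] with ω hω
  by_contra h
  push Not at h
  have : f ω = 0 := Finset.sum_eq_zero fun k hk => by
    have hk : k ≤ P.m := by simpa [Nat.lt_succ_iff] using hk
    simp [h k hk]
  simp [this] at hω

/-- increments -/
def dA (n : ℕ) (ω : Ω) : ℝ := (P.A (n + 1) ω : ℝ) - P.A n ω
def dX (n : ℕ) (ω : Ω) : ℝ := (P.X (n + 1) ω : ℝ) - P.X n ω

lemma step_int {n : ℕ} {w : Ω → ℝ} (hw : P.Good n w) (g : ℝ → ℝ → ℝ) :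
    ∫ ω, w ω * g (P.dA n ω) (P.dX n ω) ∂P.μ =
    ∫ ω, w ω * ∑ k ∈ Finset.range (P.m + 1), P.bb n k ω *
      (P.p k * g 1 (k + P.m) + (1 - P.p k) * g 0 k) ∂P.μ := by
  have := P.isProb
  have hiR : ∀ k, Integrable (fun ω => w ω * (P.Rd n k).indicator (fun _ => (1 : ℝ)) ω) P.μ := by
    intro k
    refine (hw.integrable.indicator (P.mRd n k)).congr (ae_of_all _ fun ω => ?_)
    by_cases h : ω ∈ P.Rd n k <;> simp [h]
  have hiB : ∀ k, Integrable (fun ω => w ω * (P.Bl n k).indicator (fun _ => (1 : ℝ)) ω) P.μ := by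
    intro k
    refine (hw.integrable.indicator (P.mBl n k)).congr (ae_of_all _ fun ω => ?_)
    by_cases h : ω ∈ P.Bl n k <;> simp [h]
  have hgR : ∀ k, Integrable (fun ω => w ω * (P.bb n k ω * P.p k)) P.μ := fun k =>
    (hw.mul ((P.good_bb n k).mul (good_const n _))).integrable
  have hgB : ∀ k, Integrable (fun ω => w ω * (P.bb n k ω * (1 - P.p k))) P.μ := fun k =>
    (hw.mul ((P.good_bb n k).mul (good_const n _))).integrable
  have e1 : ∀ᵐ ω ∂P.μ, w ω * g (P.dA n ω) (P.dX n ω) = ∑ k ∈ Finset.range (P.m + 1),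
      (w ω * (P.Rd n k).indicator (fun _ => (1 : ℝ)) ω * g 1 (k + P.m)
        + w ω * (P.Bl n k).indicator (fun _ => (1 : ℝ)) ω * g 0 k) := by
    filter_upwards [P.cover n] with ω hω
    obtain ⟨k, hk, h⟩ := hω
    rw [Finset.sum_eq_single k]
    · have hm := P.hm
      rcases h with h | h
      · have h2 : ω ∉ P.Bl n k := by
          simp only [Rd, Bl, Set.mem_ofPred_eq] at h ⊢; omega
        have ha : P.dA n ω = 1 := by simp [dA, h.1]
        have hx : P.dX n ω = k + P.m := by simp [dX, h.2]; ring
        simp [h, h2, ha, hx]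
      · have h2 : ω ∉ P.Rd n k := by
          simp only [Rd, Bl, Set.mem_ofPred_eq] at h ⊢; omega
        have ha : P.dA n ω = 0 := by simp [dA, h.1]
        have hx : P.dX n ω = k := by simp [dX, h.2]
        simp [h, h2, ha, hx]
    · intro j _ hj
      have h1 : ω ∉ P.Rd n j := by
        simp only [Rd, Bl, Set.mem_ofPred_eq] at h ⊢; omega
      have h2 : ω ∉ P.Bl n j := by
        simp only [Rd, Bl, Set.mem_ofPred_eq] at h ⊢; omega
      simp [h1, h2]
    · intro h; simp at h; omega
  rw [integral_congr_ae e1, integral_finsetSum]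
  swap
  · exact fun k _ => ((hiR k).mul_const _).add ((hiB k).mul_const _)
  have e2 : ∀ k ∈ Finset.range (P.m + 1),
      ∫ ω, (w ω * (P.Rd n k).indicator (fun _ => (1 : ℝ)) ω * g 1 (k + P.m)
        + w ω * (P.Bl n k).indicator (fun _ => (1 : ℝ)) ω * g 0 k) ∂P.μ
      = ∫ ω, (w ω * (P.bb n k ω * P.p k) * g 1 (k + P.m)
        + w ω * (P.bb n k ω * (1 - P.p k)) * g 0 k) ∂P.μ := by
    intro k hk
    have hk : k ≤ P.m := by simpa [Nat.lt_succ_iff] using hk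
    rw [integral_add ((hiR k).mul_const _) ((hiB k).mul_const _),
      integral_add ((hgR k).mul_const _) ((hgB k).mul_const _),
      integral_mul_const, integral_mul_const, integral_mul_const, integral_mul_const,
      P.int_red hw hk, P.int_blue hw hk]
  rw [Finset.sum_congr rfl e2, ← integral_finsetSum]
  swap
  · exact fun k _ => ((hgR k).mul_const _).add ((hgB k).mul_const _)
  congr 1; ext ω
  rw [Finset.mul_sum]
  exact Finset.sum_congr rfl fun k _ => by ring

lemma dX_bd : ∀ᵐ ω ∂P.μ, ∀ n, 0 ≤ P.dX n ω ∧ P.dX n ω ≤ 2 * P.m := by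
  rw [ae_all_iff]
  intro n
  filter_upwards [P.cover n] with ω hω
  obtain ⟨k, hk, h⟩ := hω
  have hk' : (k : ℝ) ≤ P.m := by exact_mod_cast hk
  have hk0 : (0 : ℝ) ≤ k := by positivity
  have hm0 : (0 : ℝ) ≤ P.m := by positivity
  rcases h with h | h
  · have hx : P.dX n ω = k + P.m := by simp [dX, h.2]; ring
    rw [hx]; constructor <;> linarith
  · have hx : P.dX n ω = k := by simp [dX, h.2]
    rw [hx]; constructor <;> linarith

lemma N_bd : ∀ᵐ ω ∂P.μ, ∀ n, |P.dX n ω - 2 * P.m * P.dA n ω| ≤ P.m := by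
  rw [ae_all_iff]
  intro n
  filter_upwards [P.cover n] with ω hω
  obtain ⟨k, hk, h⟩ := hω
  have hk' : (k : ℝ) ≤ P.m := by exact_mod_cast hk
  have hk0 : (0 : ℝ) ≤ k := by positivity
  rcases h with h | h
  · have hx : P.dX n ω = k + P.m := by simp [dX, h.2]; ring
    have ha : P.dA n ω = 1 := by simp [dA, h.1]
    rw [hx, ha, abs_le]; constructor <;> linarith
  · have hx : P.dX n ω = k := by simp [dX, h.2]
    have ha : P.dA n ω = 0 := by simp [dA, h.1]
    rw [hx, ha, abs_le]; constructor <;> linarith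

end PAProcess

namespace PAProcess

variable {Ω : Type} [MeasurableSpace Ω] (P : PAProcess Ω)

lemma lin1 (hlin : ∀ k ≤ P.m, P.p k = (k : ℝ) / P.m) {n : ℕ} {w : Ω → ℝ} (hw : P.Good n w) :
    ∫ ω, w ω * P.dX n ω ∂P.μ = ∫ ω, w ω * (2 * P.m * P.x n ω) ∂P.μ := by
  have hm : (P.m : ℝ) ≠ 0 := by have := P.hm; positivity
  rw [P.step_int hw (fun _ d => d)]
  congr 1; ext ω; congr 1
  have h1 := bern1 P.m (P.x n ω)
  rw [mul_assoc, ← h1, Finset.mul_sum]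
  refine Finset.sum_congr rfl fun k hk => ?_
  have hk : k ≤ P.m := by simpa [Nat.lt_succ_iff] using hk
  rw [hlin k hk, bb]
  field_simp
  ring

lemma linN (hlin : ∀ k ≤ P.m, P.p k = (k : ℝ) / P.m) {n : ℕ} {w : Ω → ℝ} (hw : P.Good n w) :
    ∫ ω, w ω * (P.dX n ω - 2 * P.m * P.dA n ω) ∂P.μ = 0 := by
  have hm : (P.m : ℝ) ≠ 0 := by have := P.hm; positivity
  rw [P.step_int hw (fun a d => d - 2 * P.m * a)]
  refine (integral_congr_ae (ae_of_all _ fun ω => ?_)).trans (integral_zero Ω ℝ)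
  rw [Finset.sum_eq_zero, mul_zero]
  intro k hk
  have hk : k ≤ P.m := by simpa [Nat.lt_succ_iff] using hk
  rw [hlin k hk]
  field_simp
  ring

lemma lin2 (hlin : ∀ k ≤ P.m, P.p k = (k : ℝ) / P.m) {n : ℕ} {w : Ω → ℝ} (hw : P.Good n w) :
    ∫ ω, w ω * P.dX n ω ^ 2 ∂P.μ = ∫ ω, w ω *
      (3 * (P.m * P.x n ω * (1 - P.x n ω) + (P.m * P.x n ω) ^ 2) + P.m * (P.m * P.x n ω)) ∂P.μ := by
  have hm : (P.m : ℝ) ≠ 0 := by have := P.hm; positivity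
  rw [P.step_int hw (fun _ d => d ^ 2)]
  congr 1; ext ω; congr 1
  rw [← bern2 P.m (P.x n ω), Finset.mul_sum,
    ← bern1 P.m (P.x n ω), Finset.mul_sum, ← Finset.sum_add_distrib]
  refine Finset.sum_congr rfl fun k hk => ?_
  have hk : k ≤ P.m := by simpa [Nat.lt_succ_iff] using hk
  rw [hlin k hk, bb]
  field_simp
  ring

def dx (n : ℕ) (ω : Ω) : ℝ := P.x (n + 1) ω - P.x n ω

lemma X_eq (hX0 : 0 < P.X0) (n : ℕ) (ω : Ω) : (P.X n ω : ℝ) = P.S n * P.x n ω := by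
  have := P.S_pos hX0 n
  unfold x; field_simp

lemma dx_eq (hX0 : 0 < P.X0) (n : ℕ) (ω : Ω) :
    P.dx n ω = (P.dX n ω - 2 * P.m * P.x n ω) / P.S (n + 1) := by
  have h1 := P.S_pos hX0 (n + 1)
  have h2 := P.S_succ n
  rw [eq_div_iff (by positivity), dX, P.X_eq hX0, P.X_eq hX0, dx, h2]
  ring

lemma good_dX (hX0 : 0 < P.X0) (n : ℕ) : P.Good (n + 1) (P.dX n) := by
  have h1 : P.Good (n + 1) (fun ω => P.S (n + 1) * P.x (n + 1) ω) :=
    P.good_x (n + 1) (f := fun x => P.S (n + 1) * x) (by fun_prop)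
  have h2 : P.Good (n + 1) (fun ω => -(P.S n * P.x n ω)) :=
    (P.good_x n (f := fun x => -(P.S n * x)) (by fun_prop)).mono (Nat.le_succ n)
  have : P.dX n = fun ω => P.S (n + 1) * P.x (n + 1) ω + -(P.S n * P.x n ω) := by
    ext ω; rw [dX, P.X_eq hX0, P.X_eq hX0]; ring
  rw [this]
  exact h1.add h2

lemma good_dx (n : ℕ) : P.Good (n + 1) (P.dx n) := by
  have h1 : P.Good (n + 1) (fun ω => P.x (n + 1) ω) :=
    P.good_x (n + 1) (f := fun x => x) (by fun_prop)
  have h2 : P.Good (n + 1) (fun ω => -P.x n ω) :=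
    (P.good_x n (f := fun x => -x) (by fun_prop)).mono (Nat.le_succ n)
  exact h1.add h2

def kap : ℝ := (P.m : ℝ) ^ 2 + 3 * P.m

lemma onestep (hlin : ∀ k ≤ P.m, P.p k = (k : ℝ) / P.m) (hX0 : 0 < P.X0)
    {n : ℕ} {w : Ω → ℝ} (hw : P.Good n w) {f0 f1 f2 : ℝ → ℝ} (h0 : Continuous f0)
    (h1 : Continuous f1) (h2 : Continuous f2) :
    ∫ ω, w ω * (f0 (P.x n ω) + f1 (P.x n ω) * P.dx n ω + f2 (P.x n ω) * P.dx n ω ^ 2) ∂P.μ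
    = ∫ ω, w ω * (f0 (P.x n ω) + f2 (P.x n ω) *
        (P.kap * (P.x n ω * (1 - P.x n ω)) / (P.S (n + 1) : ℝ) ^ 2)) ∂P.μ := by
  have hS := P.S_pos hX0 (n + 1)
  have hS0 : (P.S (n + 1) : ℝ) ≠ 0 := by positivity
  set s : ℝ := ((P.S (n + 1) : ℕ) : ℝ) with hs
  have g0 := hw.mul (P.good_x n (f := fun x => f0 x - f1 x * (2 * P.m / s) * x
    + f2 x * (2 * P.m / s) ^ 2 * x ^ 2) (by fun_prop))
  have g1 := hw.mul (P.good_x n (f := fun x => f1 x / s - 2 * f2 x * (2 * P.m / s ^ 2) * x)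
    (by fun_prop))
  have g2 := hw.mul (P.good_x n (f := fun x => f2 x / s ^ 2) (by fun_prop))
  have gd := P.good_dX hX0 n
  have i1 := ((g1.mono (Nat.le_succ n)).mul gd).integrable
  have i2 := ((g2.mono (Nat.le_succ n)).mul (gd.mul gd)).integrable
  have j1 := (g1.mul (P.good_x n (f := fun x => 2 * P.m * x) (by fun_prop))).integrable
  have j2 := (g2.mul (P.good_x n (f := fun x => 3 * (P.m * x * (1 - x) + (P.m * x) ^ 2)
    + P.m * (P.m * x)) (by fun_prop))).integrable
  have e1 := P.lin1 hlin g1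
  have e2 := P.lin2 hlin g2
  simp only [sq (P.dX n _)] at e2
  have k1 := integral_add (g0.integrable.add i1) i2
  have k2 := integral_add g0.integrable i1
  have l1 := integral_add (g0.integrable.add j1) j2
  have l2 := integral_add g0.integrable j1
  simp only [Pi.add_apply] at k1 k2 l1 l2
  rw [k2, e1, e2, ← l2, ← l1] at k1
  refine Eq.trans ?_ (k1.trans ?_)
  · congr 1; ext ω
    rw [P.dx_eq hX0, ← hs]
    field_simp
    ring
  · congr 1; ext ω
    rw [kap]
    field_simp
    ring

lemma dx_bd (hX0 : 0 < P.X0) : ∀ᵐ ω ∂P.μ, ∀ n, |P.dx n ω| ≤ 2 * P.m / P.S (n + 1) := by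
  filter_upwards [P.dX_bd] with ω hω n
  have hS := P.S_pos hX0 (n + 1)
  have hx := P.x_mem n ω
  have := hω n
  have hm : (0 : ℝ) ≤ P.m := by positivity
  have h1 : 0 ≤ P.m * P.x n ω := mul_nonneg hm hx.1
  have h2 : P.m * P.x n ω ≤ P.m := mul_le_of_le_one_right hm hx.2
  rw [P.dx_eq hX0, abs_div, abs_of_pos (by linarith : (0 : ℝ) < P.S (n + 1))]
  gcongr
  rw [abs_le]; constructor <;> linarith

lemma x_mart (hlin : ∀ k ≤ P.m, P.p k = (k : ℝ) / P.m) (hX0 : 0 < P.X0) :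
    Martingale P.x P.F P.μ := by
  have := P.isProb
  have hi : ∀ i, P.Good i (P.x i) := fun i => P.good_x i (f := fun x => x) (by fun_prop)
  refine martingale_of_setIntegral_eq_succ (fun i => (P.x_meas i).stronglyMeasurable)
    (fun i => (hi i).integrable) fun i s hs => ?_
  have h := P.onestep hlin hX0 (good_ind hs) (f0 := fun x => x) (f1 := fun _ => 1)
    (f2 := fun _ => 0) (by fun_prop) (by fun_prop) (by fun_prop)
  rw [← integral_indicator (P.F.le i s hs), ← integral_indicator (P.F.le i s hs)]
  refine Eq.trans ?_ (h.symm.trans ?_)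
  · congr 1; ext ω
    by_cases h : ω ∈ s <;> simp [h]
  · congr 1; ext ω
    by_cases h : ω ∈ s <;> simp [h, dx]

def xi : Ω → ℝ := fun ω => limsup (fun n => P.x n ω) atTop

lemma xi_meas : StronglyMeasurable[⨆ n, P.F n] P.xi := by
  refine Measurable.stronglyMeasurable ?_
  exact Measurable.limsup fun n => (P.x_meas n).mono (le_iSup (fun n => P.F n) n) le_rfl

lemma xi_lim (hlin : ∀ k ≤ P.m, P.p k = (k : ℝ) / P.m) (hX0 : 0 < P.X0) :
    ∀ᵐ ω ∂P.μ, Tendsto (fun n => P.x n ω) atTop (nhds (P.xi ω)) := by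
  have := P.isProb
  suffices h : ∀ᵐ ω ∂P.μ, ∃ c, Tendsto (fun n => P.x n ω) atTop (nhds c) by
    filter_upwards [h] with ω hω
    obtain ⟨c, hc⟩ := hω
    have : P.xi ω = c := hc.limsup_eq
    rwa [this]
  refine (P.x_mart hlin hX0).submartingale.exists_ae_tendsto_of_bdd (R := 1) fun n => ?_
  refine (eLpNorm_le_of_ae_bound (C := 1) (ae_of_all _ fun ω => ?_)).trans ?_
  · have := P.x_mem n ω
    rw [Real.norm_eq_abs, abs_of_nonneg this.1]; exact this.2
  · simp

/-- potential function bound -/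
lemma potential (hlin : ∀ k ≤ P.m, P.p k = (k : ℝ) / P.m) (hX0 : 0 < P.X0)
    (φ f0 f1 f2 : ℕ → ℝ → ℝ) (ψ : ℝ → ℝ) (hφ : ∀ k, Continuous (φ k))
    (h0 : ∀ k, Continuous (f0 k)) (h1 : ∀ k, Continuous (f1 k)) (h2 : ∀ k, Continuous (f2 k))
    (hup : ∀ k, ∀ x ∈ Set.Icc (0 : ℝ) 1, ∀ d : ℝ, |d| ≤ 2 * P.m / P.S (k + 1) →
      x + d ∈ Set.Icc (0 : ℝ) 1 → φ (k + 1) (x + d) ≤ f0 k x + f1 k x * d + f2 k x * d ^ 2)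
    (hdn : ∀ k, ∀ x ∈ Set.Icc (0 : ℝ) 1, f0 k x + f2 k x *
        (P.kap * (x * (1 - x)) / (P.S (k + 1) : ℝ) ^ 2) ≤ φ k x)
    (C : ℝ) (hC : ∀ k, ∀ x ∈ Set.Icc (0 : ℝ) 1, |φ k x| ≤ C)
    (hψ : ∀ (u : ℕ → ℝ) (y : ℝ), Tendsto u atTop (nhds y) →
      Tendsto (fun k => φ k (u k)) atTop (nhds (ψ y)))
    {n : ℕ} {w : Ω → ℝ} (hw : P.Good n w) (hw0 : ∀ ω, 0 ≤ w ω) :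
    ∫ ω, w ω * ψ (P.xi ω) ∂P.μ ≤ ∫ ω, w ω * φ n (P.x n ω) ∂P.μ := by
  have := P.isProb
  have step : ∀ k, n ≤ k → ∫ ω, w ω * φ k (P.x k ω) ∂P.μ ≤ ∫ ω, w ω * φ n (P.x n ω) ∂P.μ := by
    intro k hk
    induction k, hk using Nat.le_induction with
    | base => exact le_rfl
    | succ k hk ih =>
      refine le_trans ?_ ih
      have hwk := hw.mono hk
      have hwk' := hwk.mono (Nat.le_succ k)
      have gd := P.good_dx k
      have e := P.onestep hlin hX0 hwk (h0 k) (h1 k) (h2 k)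
      calc ∫ ω, w ω * φ (k + 1) (P.x (k + 1) ω) ∂P.μ
          ≤ ∫ ω, w ω * (f0 k (P.x k ω) + f1 k (P.x k ω) * P.dx k ω
              + f2 k (P.x k ω) * P.dx k ω ^ 2) ∂P.μ := by
            apply integral_mono_ae
            · exact (hwk'.mul (P.good_x (k + 1) (hφ (k + 1)))).integrable
            · have a0 := (P.good_x k (h0 k)).mono (Nat.le_succ k)
              have a1 := ((P.good_x k (h1 k)).mono (Nat.le_succ k)).mul gd
              have a2 := ((P.good_x k (h2 k)).mono (Nat.le_succ k)).mul (gd.mul gd)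
              simp only [sq (P.dx k _)]
              exact (hwk'.mul ((a0.add a1).add a2)).integrable
            · filter_upwards [P.dx_bd hX0] with ω hω
              have hx1 : P.x (k + 1) ω = P.x k ω + P.dx k ω := by rw [dx]; ring
              have := hup k _ (P.x_mem k ω) _ (hω k) (hx1 ▸ P.x_mem (k + 1) ω)
              rw [← hx1] at this
              exact mul_le_mul_of_nonneg_left this (hw0 ω)
        _ = _ := e
        _ ≤ _ := by
            apply integral_mono
            · exact (hwk.mul (P.good_x k (f := fun x => f0 k x + f2 k x *
                (P.kap * (x * (1 - x)) / (P.S (k + 1) : ℝ) ^ 2)) (by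
                  have := h0 k; have := h2 k; fun_prop))).integrable
            · exact (hwk.mul (P.good_x k (hφ k))).integrable
            · intro ω
              exact mul_le_mul_of_nonneg_left (hdn k _ (P.x_mem k ω)) (hw0 ω)
  obtain ⟨D, hD⟩ := hw.2
  have lim : Tendsto (fun k => ∫ ω, w ω * φ k (P.x k ω) ∂P.μ) atTop
      (nhds (∫ ω, w ω * ψ (P.xi ω) ∂P.μ)) := by
    apply tendsto_integral_of_dominated_convergence (fun _ => D * C)
    · intro k
      exact (hw.meas.mul (P.good_x k (hφ k)).meas).aestronglyMeasurable
    · exact integrable_const _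
    · intro k
      refine ae_of_all _ fun ω => ?_
      rw [Real.norm_eq_abs, abs_mul]
      exact mul_le_mul (hD ω) (hC k _ (P.x_mem k ω)) (abs_nonneg _) ((abs_nonneg _).trans (hD ω))
    · filter_upwards [P.xi_lim hlin hX0] with ω hω
      exact (hψ _ _ hω).const_mul _
  exact le_of_tendsto lim (eventually_atTop.2 ⟨n, step⟩)

end PAProcess

namespace PAProcess

variable {Ω : Type} [MeasurableSpace Ω] (P : PAProcess Ω)

lemma criterion (W : Ω → ℝ) (hW : StronglyMeasurable[⨆ n, P.F n] W) (M : ℝ)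
    (hM : ∀ᵐ ω ∂P.μ, |W ω| ≤ M) (e : ℕ → Ω → ℝ) (he : ∀ n, P.Good n (e n))
    (ε : ℕ → ℝ) (hε : ∀ n, 0 < ε n) (hεe : ∀ n ω, ε n ≤ e n ω) (c C : ℝ) (hc : 0 < c)
    (hC : 0 < C)
    (h1 : ∀ n w, P.Good n w → (∀ ω, 0 ≤ w ω) →
      c * ∫ ω, w ω * e n ω ∂P.μ ≤ ∫ ω, w ω * W ω ∂P.μ)
    (h2 : ∀ n w, P.Good n w → (∀ ω, 0 ≤ w ω) →
      ∫ ω, w ω * W ω ^ 2 ∂P.μ ≤ C * ∫ ω, w ω * e n ω ^ 2 ∂P.μ) :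
    ∀ᵐ ω ∂P.μ, W ω ≠ 0 := by
  have := P.isProb
  have hle : ⨆ n, P.F n ≤ ‹MeasurableSpace Ω› := iSup_le fun n => P.F.le n
  have hWm : Measurable W := hW.measurable.mono hle le_rfl
  set E : Set Ω := {ω | W ω ≠ 0} with hE
  have hEm' : MeasurableSet[⨆ n, P.F n] E := hW.measurable (measurableSet_singleton 0).compl
  have hEm : MeasurableSet E := hle _ hEm'
  set g : Ω → ℝ := E.indicator (fun _ => (1 : ℝ)) with hg
  have hgi : Integrable g P.μ := (integrable_const (1 : ℝ)).indicator hEm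
  have key : ∀ n, ∀ s, MeasurableSet[P.F n] s →
      ∫ _ in s, c ^ 2 / C ∂P.μ ≤ ∫ ω in s, g ω ∂P.μ := by
    intro n s hs
    have hepos : ∀ ω, 0 < e n ω := fun ω => (hε n).trans_le (hεe n ω)
    have gt : P.Good n (fun ω => c / C / e n ω) := by
      refine ⟨(he n).1.const_div _, c / C / ε n, fun ω => ?_⟩
      rw [abs_of_pos (div_pos (div_pos hc hC) (hepos ω))]
      have := hε n
      have := hεe n ω
      gcongr
    have g1 := (good_ind hs).mul gt
    have g2 := (good_ind hs).mul (gt.mul gt)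
    have hs0 : ∀ ω, 0 ≤ s.indicator (fun _ => (1 : ℝ)) ω := fun ω =>
      Set.indicator_nonneg (fun _ _ => zero_le_one) ω
    have ht0 : ∀ ω, 0 ≤ c / C / e n ω := fun ω => (div_pos (div_pos hc hC) (hepos ω)).le
    have a1 := h1 n _ g1 fun ω => mul_nonneg (hs0 ω) (ht0 ω)
    have a2 := h2 n _ g2 fun ω => mul_nonneg (hs0 ω) (mul_nonneg (ht0 ω) (ht0 ω))
    have iW : ∀ w, P.Good n w → Integrable (fun ω => w ω * W ω) P.μ := by
      intro w hw
      obtain ⟨D, hD⟩ := hw.2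
      refine Integrable.of_bound (hw.meas.mul hWm).aestronglyMeasurable (D * M) ?_
      filter_upwards [hM] with ω hω
      rw [Real.norm_eq_abs, abs_mul]
      exact mul_le_mul (hD ω) hω (abs_nonneg _) ((abs_nonneg _).trans (hD ω))
    have iW2 : ∀ w, P.Good n w → Integrable (fun ω => w ω * W ω ^ 2) P.μ := by
      intro w hw
      obtain ⟨D, hD⟩ := hw.2
      refine Integrable.of_bound (hw.meas.mul (hWm.pow_const 2)).aestronglyMeasurable (D * M ^ 2) ?_
      filter_upwards [hM] with ω hω
      rw [Real.norm_eq_abs, abs_mul, abs_pow]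
      exact mul_le_mul (hD ω) (by gcongr) (by positivity) ((abs_nonneg _).trans (hD ω))
    have hsm : MeasurableSet s := P.F.le n s hs
    have b1 : ∫ ω, s.indicator (fun _ => (1 : ℝ)) ω * (c / C / e n ω) * e n ω ∂P.μ
        = c / C * P.μ.real s := by
      have : ∀ ω, s.indicator (fun _ => (1 : ℝ)) ω * (c / C / e n ω) * e n ω
          = s.indicator (fun _ => c / C) ω := by
        intro ω
        have := (hepos ω).ne'
        by_cases h : ω ∈ s
        · simp only [h, Set.indicator_of_mem]; field_simp
        · simp [h]
      simp only [this]
      rw [integral_indicator hsm]; simp [mul_comm]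
    have b2 : ∫ ω, s.indicator (fun _ => (1 : ℝ)) ω * (c / C / e n ω * (c / C / e n ω))
        * e n ω ^ 2 ∂P.μ = (c / C) ^ 2 * P.μ.real s := by
      have : ∀ ω, s.indicator (fun _ => (1 : ℝ)) ω * (c / C / e n ω * (c / C / e n ω))
        * e n ω ^ 2 = s.indicator (fun _ => (c / C) ^ 2) ω := by
        intro ω
        have := (hepos ω).ne'
        by_cases h : ω ∈ s
        · simp only [h, Set.indicator_of_mem]; field_simp
        · simp [h]
      simp only [this]
      rw [integral_indicator hsm]; simp [mul_comm]
    rw [b1] at a1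
    rw [b2] at a2
    have main : 2 * ∫ ω, s.indicator (fun _ => (1 : ℝ)) ω * (c / C / e n ω) * W ω ∂P.μ
        - ∫ ω, s.indicator (fun _ => (1 : ℝ)) ω * (c / C / e n ω * (c / C / e n ω)) * W ω ^ 2 ∂P.μ
        ≤ ∫ ω in s, g ω ∂P.μ := by
      rw [← integral_const_mul, ← integral_sub ((iW _ g1).const_mul 2) (iW2 _ g2),
        ← integral_indicator hsm]
      apply integral_mono (((iW _ g1).const_mul 2).sub (iW2 _ g2)) (hgi.indicator hsm)
      intro ω
      by_cases h : ω ∈ s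
      · by_cases h' : W ω = 0
        · simp [h, hg, hE, h']
        · simp only [Pi.sub_apply, h, hg, hE, Set.indicator_of_mem, Set.mem_ofPred_eq, ne_eq, h',
            not_false_eq_true]
          nlinarith [sq_nonneg (c / C / e n ω * W ω - 1)]
      · simp [h]
    have e1 : ∫ _ in s, c ^ 2 / C ∂P.μ = c ^ 2 / C * P.μ.real s := by simp [mul_comm]
    rw [e1]
    refine le_trans (le_of_eq ?_) ((sub_le_sub (mul_le_mul_of_nonneg_left a1 zero_le_two) a2).trans
      main)
    field_simp
    ring
  have hlow : ∀ n, ∀ᵐ ω ∂P.μ, c ^ 2 / C ≤ (P.μ[g | P.F n]) ω := by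
    intro n
    apply ae_le_of_ae_le_trim (hm := P.F.le n)
    apply ae_le_of_forall_setIntegral_le (integrable_const _)
      (integrable_condExp.trim (P.F.le n) stronglyMeasurable_condExp)
    intro s hs _
    rw [← setIntegral_trim (P.F.le n) stronglyMeasurable_const hs,
      ← setIntegral_trim (P.F.le n) stronglyMeasurable_condExp hs,
      setIntegral_condExp (P.F.le n) hgi hs]
    exact key n s hs
  have hconv := hgi.tendsto_ae_condExp (ℱ := P.F) (stronglyMeasurable_const.indicator hEm')
  filter_upwards [hconv, ae_all_iff.2 hlow] with ω a b h
  have := ge_of_tendsto' a b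
  have hg0 : g ω = 0 := by simp [hg, hE, h]
  rw [hg0] at this
  have : 0 < c ^ 2 / C := by positivity
  linarith

lemma xi_mem (hlin : ∀ k ≤ P.m, P.p k = (k : ℝ) / P.m) (hX0 : 0 < P.X0) :
    ∀ᵐ ω ∂P.μ, P.xi ω ∈ Set.Icc (0 : ℝ) 1 := by
  filter_upwards [P.xi_lim hlin hX0] with ω h
  exact isClosed_Icc.mem_of_tendsto h (Eventually.of_forall fun n => P.x_mem n ω)

/-- truncated red count compensated -/
def NN (n : ℕ) (ω : Ω) : ℝ :=
  (P.X n ω : ℝ) - P.X0 - 2 * P.m * ((min (P.A n ω) (P.A0 + n) : ℕ) - P.A0)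

lemma good_NN (hX0 : 0 < P.X0) (n : ℕ) : P.Good n (P.NN n) := by
  have h1 : P.Good n (fun ω => P.S n * P.x n ω - P.X0) :=
    P.good_x n (f := fun x => P.S n * x - P.X0) (by fun_prop)
  have h2 : P.Good n (fun ω => - (2 * P.m * ((min (P.A n ω) (P.A0 + n) : ℕ) - P.A0))) := by
    refine ⟨?_, 2 * P.m * (P.A0 + n + P.A0), fun ω => ?_⟩
    · have : Measurable (fun k : ℕ => -(2 * (P.m : ℝ) * ((min k (P.A0 + n) : ℕ) - P.A0))) :=
        measurable_from_top
      exact this.comp (P.adaptedA n)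
    · rw [abs_neg, abs_mul, abs_of_nonneg (by positivity : (0 : ℝ) ≤ 2 * P.m)]
      gcongr
      have : ((min (P.A n ω) (P.A0 + n) : ℕ) : ℝ) ≤ P.A0 + n := by
        exact_mod_cast min_le_right _ _
      have h0 : (0 : ℝ) ≤ ((min (P.A n ω) (P.A0 + n) : ℕ) : ℝ) := Nat.cast_nonneg _
      have h3 : (0 : ℝ) ≤ P.A0 := Nat.cast_nonneg _
      have h4 : (0 : ℝ) ≤ n := Nat.cast_nonneg _
      rw [abs_le]; constructor <;> linarith
  have : P.NN n = fun ω => (P.S n * P.x n ω - P.X0)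
      + - (2 * P.m * ((min (P.A n ω) (P.A0 + n) : ℕ) - P.A0)) := by
    ext ω; rw [NN, P.X_eq hX0]; ring
  rw [this]
  exact h1.add h2

lemma A_le : ∀ᵐ ω ∂P.μ, ∀ n, P.A n ω ≤ P.A0 + n := by
  filter_upwards [ae_all_iff.2 P.cover] with ω h n
  induction n with
  | zero => simp [P.hA0]
  | succ n ih =>
    obtain ⟨k, hk, h⟩ := h n
    simp only [Rd, Bl, Set.mem_ofPred_eq] at h
    omega

lemma NN_eq : ∀ᵐ ω ∂P.μ, ∀ n, P.NN n ω = P.X n ω - P.X0 - 2 * P.m * (P.A n ω - P.A0) := by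
  filter_upwards [P.A_le] with ω h n
  rw [NN, min_eq_left (h n)]

lemma NN_sq (hlin : ∀ k ≤ P.m, P.p k = (k : ℝ) / P.m) (hX0 : 0 < P.X0) (n : ℕ) :
    ∫ ω, P.NN n ω ^ 2 ∂P.μ ≤ P.m ^ 2 * n := by
  have := P.isProb
  induction n with
  | zero =>
    have : ∀ ω, P.NN 0 ω = 0 := fun ω => by simp [NN, P.hA0, P.hX0]
    simp [this]
  | succ n ih =>
    have gN := P.good_NN hX0 n
    have gN' := gN.mono (Nat.le_succ n)
    have gN1 := P.good_NN hX0 (n + 1)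
    have hD : ∀ᵐ ω ∂P.μ, P.NN (n + 1) ω = P.NN n ω + (P.dX n ω - 2 * P.m * P.dA n ω) := by
      filter_upwards [P.NN_eq] with ω h
      rw [h, h, dX, dA]; ring
    have gD := gN1.add ((good_const (n + 1) (-1)).mul gN')
    have e0 : ∫ ω, P.NN n ω * (P.NN (n + 1) ω + -1 * P.NN n ω) ∂P.μ = 0 := by
      rw [← P.linN hlin gN]
      apply integral_congr_ae
      filter_upwards [hD] with ω h
      rw [h]; ring
    have i1 := (gN'.mul gN').integrable
    have i2 := (gN'.mul gD).integrable
    have : ∫ ω, P.NN (n + 1) ω ^ 2 ∂P.μ ≤ ∫ ω, (P.NN n ω * P.NN n ω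
        + 2 * (P.NN n ω * (P.NN (n + 1) ω + -1 * P.NN n ω)) + (P.m : ℝ) ^ 2) ∂P.μ := by
      apply integral_mono_ae
      · simp only [sq]; exact (gN1.mul gN1).integrable
      · exact (i1.add (i2.const_mul 2)).add (integrable_const _)
      · filter_upwards [hD, P.N_bd] with ω h h'
        have h3 := sq_le_sq' (abs_le.1 (h' n)).1 (abs_le.1 (h' n)).2
        rw [h]
        nlinarith
    have k1 := integral_add (i1.add (i2.const_mul 2)) (integrable_const ((P.m : ℝ) ^ 2))
    have k2 := integral_add i1 (i2.const_mul 2)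
    simp only [Pi.add_apply] at k1 k2
    rw [k1, k2, integral_const_mul, e0] at this
    simp only [← sq] at this
    simp at this
    push_cast
    linarith

lemma S_inv_tendsto (hX0 : 0 < P.X0) :
    Tendsto (fun n => ((P.S n : ℕ) : ℝ)⁻¹) atTop (nhds 0) := by
  apply tendsto_inv_atTop_zero.comp
  apply tendsto_natCast_atTop_atTop.comp
  apply tendsto_atTop_mono _ tendsto_id
  intro n
  have := P.hm
  unfold S
  simp only [id]
  nlinarith

lemma xi_eq_L (hlin : ∀ k ≤ P.m, P.p k = (k : ℝ) / P.m) (hX0 : 0 < P.X0) (L : Ω → ℝ)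
    (hL : ∀ᵐ ω ∂P.μ, Tendsto (fun n => P.a n ω) atTop (nhds (L ω))) :
    ∀ᵐ ω ∂P.μ, P.xi ω = L ω := by
  have := P.isProb
  have hi := P.S_inv_tendsto hX0
  have hm1 : (1 : ℝ) ≤ P.m := by exact_mod_cast P.hm
  have hlim : ∀ᵐ ω ∂P.μ, Tendsto (fun n => P.NN n ω / (P.S n : ℝ)) atTop
      (nhds (P.xi ω - L ω)) := by
    filter_upwards [P.NN_eq, P.xi_lim hlin hX0, hL] with ω h1 h2 h3
    have hr : Tendsto (fun n => 1 + (2 * P.m * (P.A0 + P.B0) - P.X0 - P.Y0) * ((P.S n : ℕ) : ℝ)⁻¹)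
        atTop (nhds (1 + (2 * P.m * (P.A0 + P.B0) - P.X0 - P.Y0) * 0)) :=
      (hi.const_mul _).const_add _
    have := (h2.sub (h3.mul hr)).add (hi.const_mul (2 * P.m * P.A0 - P.X0 : ℝ))
    simp only [mul_zero, add_zero, mul_one] at this
    refine this.congr' ?_
    filter_upwards [eventually_gt_atTop 0] with n hn
    have hS := P.S_pos hX0 n
    have hn' : (0 : ℝ) < n := by exact_mod_cast hn
    have hS' : (P.S n : ℝ) = P.X0 + P.Y0 + 2 * P.m * n := by unfold S; push_cast; ring
    rw [h1, x, a]
    have : (P.A0 : ℝ) + P.B0 + n ≠ 0 := by positivity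
    have e : 1 + (2 * P.m * (P.A0 + P.B0) - P.X0 - P.Y0) * ((P.S n : ℕ) : ℝ)⁻¹
        = 2 * P.m * ((P.A0 : ℝ) + P.B0 + n) / P.S n := by
      field_simp
      rw [hS']; ring
    rw [e]
    field_simp
    ring
  have hmeas : ∀ n, Measurable (fun ω => ENNReal.ofReal ((P.NN n ω / (P.S n : ℝ)) ^ 2)) :=
    fun n => (((P.good_NN hX0 n).meas.div_const _).pow_const 2).ennreal_ofReal
  have hb : ∀ n, ∫⁻ ω, ENNReal.ofReal ((P.NN n ω / (P.S n : ℝ)) ^ 2) ∂P.μ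
      ≤ ENNReal.ofReal (P.m * ((P.S n : ℕ) : ℝ)⁻¹) := by
    intro n
    have g := P.good_NN hX0 n
    have hS := P.S_pos hX0 n
    rw [← ofReal_integral_eq_lintegral_ofReal]
    · apply ENNReal.ofReal_le_ofReal
      simp only [div_pow]
      rw [integral_div, div_le_iff₀ (by positivity)]
      refine (P.NN_sq hlin hX0 n).trans ?_
      have : (P.m : ℝ) * (P.S n : ℝ)⁻¹ * (P.S n : ℝ) ^ 2 = P.m * P.S n := by field_simp
      rw [this]
      have h5 : (P.m : ℝ) * n ≤ P.S n := by
        have : P.m * n ≤ P.S n := by unfold S; nlinarith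
        exact_mod_cast this
      nlinarith
    · simp only [div_pow, sq (P.NN n _)]
      exact (g.mul g).integrable.div_const _
    · exact ae_of_all _ fun ω => sq_nonneg _
  have hz : Tendsto (fun n => ENNReal.ofReal (P.m * ((P.S n : ℕ) : ℝ)⁻¹)) atTop (nhds 0) := by
    have := ENNReal.tendsto_ofReal (hi.const_mul (P.m : ℝ))
    simpa using this
  have hz' := tendsto_of_tendsto_of_tendsto_of_le_of_le tendsto_const_nhds hz
    (fun n => zero_le) hb
  have hf := lintegral_liminf_le (μ := P.μ) (u := atTop) hmeas
  rw [hz'.liminf_eq] at hf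
  have h0 := (lintegral_eq_zero_iff (Measurable.liminf hmeas)).1 (le_antisymm hf zero_le)
  filter_upwards [h0, hlim] with ω h h'
  have h2 := (ENNReal.tendsto_ofReal (h'.pow 2)).liminf_eq
  rw [h2] at h
  have h3 : (P.xi ω - L ω) ^ 2 ≤ 0 := by simpa using h
  have h4 : P.xi ω - L ω = 0 := by nlinarith
  linarith

end PAProcess

namespace PAProcess

variable {Ω : Type} [MeasurableSpace Ω] (P : PAProcess Ω)

lemma kap_le : P.kap ≤ 4 * (P.m : ℝ) ^ 2 := by
  have hm1 : (1 : ℝ) ≤ P.m := by exact_mod_cast P.hm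
  unfold kap; nlinarith

lemma kap_ge : (P.m : ℝ) ^ 2 ≤ P.kap := by
  have hm1 : (1 : ℝ) ≤ P.m := by exact_mod_cast P.hm
  unfold kap; nlinarith

lemma bdry_ineq {m s κ x q : ℝ} (hm : 1 ≤ m) (hs : 1 ≤ s) (hκ : κ ≤ 4 * m ^ 2)
    (hx : 0 ≤ x) (hq0 : 0 ≤ q) (hq : q ≤ x) :
    2 * m * (s + 2 * m)⁻¹ * x + 1 * (κ * q / (s + 2 * m) ^ 2) ≤ 2 * m * s⁻¹ * x := by
  have hs' : 0 < s + 2 * m := by linarith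
  have h1 : κ * q ≤ 4 * m ^ 2 * x :=
    (mul_le_mul_of_nonneg_right hκ hq0).trans (mul_le_mul_of_nonneg_left hq (by positivity))
  have h2 : κ * q / (s + 2 * m) ^ 2 ≤ 4 * m ^ 2 * x / (s * (s + 2 * m)) := by
    apply div_le_div₀ (by positivity) h1 (by positivity)
    nlinarith
  have h3 : 2 * m * s⁻¹ * x - 2 * m * (s + 2 * m)⁻¹ * x = 4 * m ^ 2 * x / (s * (s + 2 * m)) := by
    field_simp
    ring
  linarith

lemma low_ineq {m s κ : ℝ} (hm : 1 ≤ m) (hs : 1 ≤ s) (hκ : m ^ 2 ≤ κ) :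
    8⁻¹ * s⁻¹ ≤ 8⁻¹ * (s + 2 * m)⁻¹ + (1 - 8⁻¹ * (s + 2 * m)⁻¹) * (κ / (s + 2 * m) ^ 2) := by
  have hs' : 1 ≤ s + 2 * m := by linarith
  have hi : (s + 2 * m)⁻¹ ≤ 1 := inv_le_one_of_one_le₀ hs'
  have h1 : m ^ 2 / (s + 2 * m) ^ 2 ≤ κ / (s + 2 * m) ^ 2 := by gcongr
  have h0 : 0 ≤ m ^ 2 / (s + 2 * m) ^ 2 := by positivity
  have h2 : (7 / 8) * (m ^ 2 / (s + 2 * m) ^ 2)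
      ≤ (1 - 8⁻¹ * (s + 2 * m)⁻¹) * (κ / (s + 2 * m) ^ 2) :=
    mul_le_mul (by linarith) h1 h0 (by linarith)
  have h3 : 8⁻¹ * s⁻¹ - 8⁻¹ * (s + 2 * m)⁻¹ ≤ (7 / 8) * (m ^ 2 / (s + 2 * m) ^ 2) := by
    have e : 8⁻¹ * s⁻¹ - 8⁻¹ * (s + 2 * m)⁻¹ = m / 4 / (s * (s + 2 * m)) := by
      field_simp
      ring
    rw [e, ← mul_div_assoc, div_le_div_iff₀ (by positivity) (by positivity)]
    have : m / 4 * (s + 2 * m) ≤ 7 / 8 * m ^ 2 * s := by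
      have : s + 2 * m ≤ 3 * m * s := by nlinarith
      nlinarith
    have := mul_le_mul_of_nonneg_right this (by linarith : 0 ≤ s + 2 * m)
    nlinarith
  linarith

lemma up_ineq {m s v z : ℝ} (hm : 1 ≤ m) (hs : 1 ≤ s) (hv : v ≤ m ^ 2) :
    4 * m * (s + 2 * m)⁻¹ * z ^ 2 + 5 * m ^ 2 * (s + 2 * m)⁻¹ ^ 2
      + (8 * z ^ 2 + 3 * (2 * m / (s + 2 * m)) ^ 2 + 4 * m * (s + 2 * m)⁻¹)
        * (v / (s + 2 * m) ^ 2)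
    ≤ 4 * m * s⁻¹ * z ^ 2 + 5 * m ^ 2 * s⁻¹ ^ 2 := by
  set t := (s + 2 * m)⁻¹ with ht
  have hs' : 0 < s + 2 * m := by linarith
  have htp : 0 < t := inv_pos.2 hs'
  have hst : (s + 2 * m) * t = 1 := mul_inv_cancel₀ hs'.ne'
  set i := s⁻¹ with hi
  have hip : 0 < i := inv_pos.2 (by linarith)
  have hsi : s * i = 1 := mul_inv_cancel₀ (by linarith)
  -- i - t = 2 m i t
  have hit : i - t = 2 * m * (i * t) := by
    rw [hi, ht]; field_simp; ring
  have hti : t ≤ i := by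
    have : 0 ≤ 2 * m * (i * t) := by positivity
    linarith
  have hmt : 2 * m * t ≤ 1 := by nlinarith
  have hvt : v / (s + 2 * m) ^ 2 ≤ m ^ 2 * t ^ 2 := by
    rw [ht, inv_pow, ← div_eq_mul_inv]; gcongr
  have hd : 2 * m / (s + 2 * m) = 2 * m * t := by rw [ht, div_eq_mul_inv]
  rw [hd]
  have hA : 0 ≤ 8 * z ^ 2 + 3 * (2 * m * t) ^ 2 + 4 * m * t := by positivity
  have h1 := mul_le_mul_of_nonneg_left hvt hA
  have hit2 : t * t ≤ i * t := mul_le_mul_of_nonneg_right hti htp.le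
  -- z part
  have hz : 8 * z ^ 2 * (m ^ 2 * t ^ 2) ≤ 4 * m * z ^ 2 * (i - t) := by
    rw [hit]
    have : 0 ≤ 8 * z ^ 2 * m ^ 2 * (i * t - t * t) := by
      apply mul_nonneg (by positivity); linarith
    nlinarith
  have hc : (3 * (2 * m * t) ^ 2 + 4 * m * t) * (m ^ 2 * t ^ 2) ≤ 5 * m ^ 2 * (i ^ 2 - t ^ 2) := by
    have e1 : i ^ 2 - t ^ 2 = 2 * m * (i * t) * (i + t) := by
      rw [← hit]; ring
    have e2 : t * t * t ≤ i * t * (i + t) := by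
      have : t * t * t ≤ i * t * t := mul_le_mul_of_nonneg_right hit2 htp.le
      have : 0 ≤ i * t * i := by positivity
      linarith
    have e3 : 3 * (2 * m * t) ^ 2 + 4 * m * t ≤ 10 * m * t := by
      have : (2 * m * t) ^ 2 ≤ 2 * m * t := by
        have : 0 ≤ 2 * m * t := by positivity
        nlinarith
      linarith
    have e4 := mul_le_mul_of_nonneg_right e3 (by positivity : 0 ≤ m ^ 2 * t ^ 2)
    have e5 := mul_le_mul_of_nonneg_left e2 (by positivity : 0 ≤ 10 * m ^ 3)
    rw [e1]
    nlinarith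
  nlinarith

lemma quart {z d b : ℝ} (h : |d| ≤ b) :
    (z + d) ^ 4 ≤ z ^ 4 + 4 * z ^ 3 * d + (8 * z ^ 2 + 3 * b ^ 2) * d ^ 2 := by
  have h1 : d ^ 2 ≤ b ^ 2 := by rw [← sq_abs]; gcongr
  have h2 : d ^ 2 * d ^ 2 ≤ b ^ 2 * d ^ 2 := mul_le_mul_of_nonneg_right h1 (sq_nonneg d)
  have h3 : 0 ≤ (d * (z - d)) ^ 2 := sq_nonneg _
  nlinarith

section


lemma mom1 (hlin : ∀ k ≤ P.m, P.p k = (k : ℝ) / P.m) (hX0 : 0 < P.X0)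
    (σ τ : ℝ) {n : ℕ} {w : Ω → ℝ} (hw : P.Good n w) (hw0 : ∀ ω, 0 ≤ w ω) :
    ∫ ω, w ω * (σ + τ * P.x n ω) ∂P.μ ≤ ∫ ω, w ω * (σ + τ * P.xi ω) ∂P.μ := by
  have h := P.potential hlin hX0 (fun _ x => -(σ + τ * x)) (fun _ x => -(σ + τ * x))
    (fun _ _ => -τ) (fun _ _ => 0) (fun x => -(σ + τ * x)) (by fun_prop) (by fun_prop)
    (by fun_prop) (by fun_prop) (fun k x _ d _ _ => by linarith) (fun k x _ => by simp)
    (|σ| + |τ|) (fun k x hx => by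
      rw [abs_neg]
      refine (abs_add_le _ _).trans ?_
      rw [abs_mul, abs_of_nonneg hx.1]
      have := mul_le_of_le_one_right (abs_nonneg τ) hx.2
      linarith)
    (fun u y hu => ((hu.const_mul τ).const_add σ).neg) hw hw0
  simp only [mul_neg, integral_neg] at h
  linarith

/-- second moment bound; `y = x` or `y = 1 - x` -/
lemma mom2 (hlin : ∀ k ≤ P.m, P.p k = (k : ℝ) / P.m) (hX0 : 0 < P.X0)
    (σ τ : ℝ) (hστ : (σ = 0 ∧ τ = 1) ∨ (σ = 1 ∧ τ = -1))
    {n : ℕ} {w : Ω → ℝ} (hw : P.Good n w) (hw0 : ∀ ω, 0 ≤ w ω) :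
    ∫ ω, w ω * (σ + τ * P.xi ω) ^ 2 ∂P.μ ≤
      ∫ ω, w ω * ((σ + τ * P.x n ω) ^ 2 + 2 * P.m * ((P.S n : ℕ) : ℝ)⁻¹ * (σ + τ * P.x n ω)) ∂P.μ := by
  have hm1 : (1 : ℝ) ≤ P.m := by exact_mod_cast P.hm
  have hτ : τ ^ 2 = 1 := by rcases hστ with h | h <;> rw [h.2] <;> norm_num
  have hy : ∀ x ∈ Set.Icc (0 : ℝ) 1, 0 ≤ σ + τ * x ∧ σ + τ * x ≤ 1 ∧
      x * (1 - x) ≤ σ + τ * x ∧ 0 ≤ x * (1 - x) := by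
    intro x hx
    obtain ⟨h0, h1⟩ := hx
    rcases hστ with h | h <;> rw [h.1, h.2] <;> refine ⟨?_, ?_, ?_, ?_⟩ <;> nlinarith
  refine P.potential hlin hX0
    (fun k x => (σ + τ * x) ^ 2 + 2 * P.m * ((P.S k : ℕ) : ℝ)⁻¹ * (σ + τ * x))
    (fun k x => (σ + τ * x) ^ 2 + 2 * P.m * ((P.S (k + 1) : ℕ) : ℝ)⁻¹ * (σ + τ * x))
    (fun k x => 2 * τ * (σ + τ * x) + 2 * P.m * ((P.S (k + 1) : ℕ) : ℝ)⁻¹ * τ)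
    (fun _ _ => 1) (fun x => (σ + τ * x) ^ 2)
    (by fun_prop) (by fun_prop) (by fun_prop) (by fun_prop) ?_ ?_ (1 + 2 * P.m) ?_ ?_ hw hw0
  · intro k x _ d _ _
    apply le_of_eq
    have : d ^ 2 = τ ^ 2 * d ^ 2 := by rw [hτ, one_mul]
    rw [one_mul, this]
    ring
  · intro k x hx
    have hS := P.S_pos hX0 k
    obtain ⟨a, b, c, d⟩ := hy x hx
    have := bdry_ineq hm1 hS P.kap_le a d c
    simp only [S_succ]
    linarith
  · intro k x hx
    have hS := P.S_pos hX0 k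
    obtain ⟨a, b, c, d⟩ := hy x hx
    have hi : ((P.S k : ℕ) : ℝ)⁻¹ ≤ 1 := inv_le_one_of_one_le₀ hS
    have hi0 : 0 ≤ ((P.S k : ℕ) : ℝ)⁻¹ := by positivity
    rw [abs_of_nonneg (by positivity)]
    have : ((P.S k : ℕ) : ℝ)⁻¹ * (σ + τ * x) ≤ 1 := by nlinarith
    nlinarith
  · intro u y hu
    have h1 := (hu.const_mul τ).const_add σ
    have h2 := (h1.pow 2).add (((P.S_inv_tendsto hX0).const_mul (2 * (P.m : ℝ))).mul h1)
    simpa using h2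

lemma mom2low (hlin : ∀ k ≤ P.m, P.p k = (k : ℝ) / P.m) (hX0 : 0 < P.X0)
    (r : ℝ) {n : ℕ} {w : Ω → ℝ} (hw : P.Good n w) (hw0 : ∀ ω, 0 ≤ w ω) :
    ∫ ω, w ω * ((P.x n ω - r) ^ 2 + 8⁻¹ * ((P.S n : ℕ) : ℝ)⁻¹ * (P.x n ω * (1 - P.x n ω))) ∂P.μ
      ≤ ∫ ω, w ω * (P.xi ω - r) ^ 2 ∂P.μ := by
  have hm1 : (1 : ℝ) ≤ P.m := by exact_mod_cast P.hm
  have h := P.potential hlin hX0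
    (fun k x => -((x - r) ^ 2 + 8⁻¹ * ((P.S k : ℕ) : ℝ)⁻¹ * (x * (1 - x))))
    (fun k x => -((x - r) ^ 2 + 8⁻¹ * ((P.S (k + 1) : ℕ) : ℝ)⁻¹ * (x * (1 - x))))
    (fun k x => -(2 * (x - r) + 8⁻¹ * ((P.S (k + 1) : ℕ) : ℝ)⁻¹ * (1 - 2 * x)))
    (fun k _ => -(1 - 8⁻¹ * ((P.S (k + 1) : ℕ) : ℝ)⁻¹)) (fun x => -(x - r) ^ 2)
    (by fun_prop) (by fun_prop) (by fun_prop) (by fun_prop)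
    (fun k x _ d _ _ => le_of_eq (by ring)) ?_ ((1 + |r|) ^ 2 + 1) ?_ ?_ hw hw0
  · simp only [mul_neg, integral_neg] at h
    linarith
  · intro k x hx
    have hS := P.S_pos hX0 k
    have hq : 0 ≤ x * (1 - x) := mul_nonneg hx.1 (by linarith [hx.2])
    have := mul_le_mul_of_nonneg_right (low_ineq hm1 hS P.kap_ge) hq
    simp only [S_succ]
    have e : P.kap * (x * (1 - x)) / ((P.S k : ℝ) + 2 * P.m) ^ 2
      = P.kap / ((P.S k : ℝ) + 2 * P.m) ^ 2 * (x * (1 - x)) := by ring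
    rw [e]
    linarith
  · intro k x hx
    have hS := P.S_pos hX0 k
    have hi : ((P.S k : ℕ) : ℝ)⁻¹ ≤ 1 := inv_le_one_of_one_le₀ hS
    have hi0 : 0 ≤ ((P.S k : ℕ) : ℝ)⁻¹ := by positivity
    have hq : 0 ≤ x * (1 - x) := mul_nonneg hx.1 (by linarith [hx.2])
    have hq1 : x * (1 - x) ≤ 1 := by nlinarith [sq_nonneg x, hx.2]
    have hz : |x - r| ≤ 1 + |r| := by
      refine (abs_sub _ _).trans ?_
      rw [abs_of_nonneg hx.1]; linarith [hx.2]
    have hz2 : (x - r) ^ 2 ≤ (1 + |r|) ^ 2 := by rw [← sq_abs]; gcongr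
    rw [abs_neg, abs_of_nonneg (by positivity)]
    have : ((P.S k : ℕ) : ℝ)⁻¹ * (x * (1 - x)) ≤ 1 := by nlinarith
    nlinarith
  · intro u y hu
    have h1 := (hu.sub_const r).pow 2
    have h2 := hu.mul (hu.const_sub 1)
    have h3 := (h1.add (((P.S_inv_tendsto hX0).const_mul (8⁻¹ : ℝ)).mul h2)).neg
    simpa using h3

lemma mom4 (hlin : ∀ k ≤ P.m, P.p k = (k : ℝ) / P.m) (hX0 : 0 < P.X0)
    (r : ℝ) {n : ℕ} {w : Ω → ℝ} (hw : P.Good n w) (hw0 : ∀ ω, 0 ≤ w ω) :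
    ∫ ω, w ω * (P.xi ω - r) ^ 4 ∂P.μ ≤
    ∫ ω, w ω * ((P.x n ω - r) ^ 4 + 4 * P.m * ((P.S n : ℕ) : ℝ)⁻¹ * (P.x n ω - r) ^ 2
      + 5 * P.m ^ 2 * ((P.S n : ℕ) : ℝ)⁻¹ ^ 2) ∂P.μ := by
  have hm1 : (1 : ℝ) ≤ P.m := by exact_mod_cast P.hm
  refine P.potential hlin hX0
    (fun k x => (x - r) ^ 4 + 4 * P.m * ((P.S k : ℕ) : ℝ)⁻¹ * (x - r) ^ 2
      + 5 * P.m ^ 2 * ((P.S k : ℕ) : ℝ)⁻¹ ^ 2)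
    (fun k x => (x - r) ^ 4 + 4 * P.m * ((P.S (k + 1) : ℕ) : ℝ)⁻¹ * (x - r) ^ 2
      + 5 * P.m ^ 2 * ((P.S (k + 1) : ℕ) : ℝ)⁻¹ ^ 2)
    (fun k x => 4 * (x - r) ^ 3 + 8 * P.m * ((P.S (k + 1) : ℕ) : ℝ)⁻¹ * (x - r))
    (fun k x => 8 * (x - r) ^ 2 + 3 * (2 * P.m / ((P.S (k + 1) : ℕ) : ℝ)) ^ 2
      + 4 * P.m * ((P.S (k + 1) : ℕ) : ℝ)⁻¹) (fun x => (x - r) ^ 4)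
    (by fun_prop) (by fun_prop) (by fun_prop) (by fun_prop) ?_ ?_
    ((1 + |r|) ^ 4 + 4 * P.m * (1 + |r|) ^ 2 + 5 * P.m ^ 2) ?_ ?_ hw hw0
  · intro k x _ d hd _
    have := quart (z := x - r) hd
    have e : x + d - r = x - r + d := by ring
    rw [e]
    linarith
  · intro k x hx
    have hS := P.S_pos hX0 k
    have hv : P.kap * (x * (1 - x)) ≤ P.m ^ 2 := by
      have hq : 0 ≤ x * (1 - x) := mul_nonneg hx.1 (by linarith [hx.2])
      have h1 := mul_le_mul_of_nonneg_right P.kap_le hq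
      have h2 : x * (1 - x) ≤ 1 / 4 := by nlinarith [sq_nonneg (x - 1 / 2)]
      have h3 := mul_le_mul_of_nonneg_left h2 (by positivity : 0 ≤ 4 * (P.m : ℝ) ^ 2)
      linarith
    have := up_ineq (z := x - r) hm1 hS hv
    simp only [S_succ]
    linarith
  · intro k x hx
    have hS := P.S_pos hX0 k
    have hi : ((P.S k : ℕ) : ℝ)⁻¹ ≤ 1 := inv_le_one_of_one_le₀ hS
    have hi0 : 0 ≤ ((P.S k : ℕ) : ℝ)⁻¹ := by positivity
    have hz : |x - r| ≤ 1 + |r| := by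
      refine (abs_sub _ _).trans ?_
      rw [abs_of_nonneg hx.1]; linarith [hx.2]
    have hz2 : (x - r) ^ 2 ≤ (1 + |r|) ^ 2 := by rw [← sq_abs]; gcongr
    have hz4 : (x - r) ^ 4 ≤ (1 + |r|) ^ 4 := by
      have : (x - r) ^ 4 = |x - r| ^ 4 := by rw [pow_abs, abs_of_nonneg (by positivity)]
      rw [this]; gcongr
    rw [abs_of_nonneg (by positivity)]
    have h1 : 4 * (P.m : ℝ) * ((P.S k : ℕ) : ℝ)⁻¹ * (x - r) ^ 2 ≤ 4 * P.m * 1 * (1 + |r|) ^ 2 := by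
      gcongr
    have h2 : 5 * (P.m : ℝ) ^ 2 * ((P.S k : ℕ) : ℝ)⁻¹ ^ 2 ≤ 5 * P.m ^ 2 * 1 ^ 2 := by
      gcongr
    linarith
  · intro u y hu
    have h1 := hu.sub_const r
    have hi := P.S_inv_tendsto hX0
    have h3 := ((h1.pow 4).add ((hi.const_mul (4 * (P.m : ℝ))).mul (h1.pow 2))).add
      ((hi.pow 2).const_mul (5 * (P.m : ℝ) ^ 2))
    simpa using h3

end

end PAProcess

namespace PAProcess

variable {Ω : Type} [MeasurableSpace Ω] (P : PAProcess Ω)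

lemma X_low : ∀ᵐ ω ∂P.μ, ∀ n, (P.X0 : ℝ) ≤ P.X n ω ∧ (P.X n ω : ℝ) + P.Y0 ≤ P.S n := by
  filter_upwards [P.dX_bd] with ω hω n
  induction n with
  | zero =>
    rw [P.hX0]
    simp [S]
  | succ n ih =>
    have h := hω n
    have hs := P.S_succ n
    unfold dX at h
    constructor <;> linarith [h.1, h.2, ih.1, ih.2]

lemma bdry (hlin : ∀ k ≤ P.m, P.p k = (k : ℝ) / P.m) (hX0 : 0 < P.X0) (hY0 : 0 < P.Y0)
    (σ τ : ℝ) (hστ : (σ = 0 ∧ τ = 1) ∨ (σ = 1 ∧ τ = -1)) :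
    ∀ᵐ ω ∂P.μ, σ + τ * P.xi ω ≠ 0 := by
  have hm1 : (1 : ℝ) ≤ P.m := by exact_mod_cast P.hm
  have hX1 : (1 : ℝ) ≤ P.X0 := by exact_mod_cast hX0
  have hY1 : (1 : ℝ) ≤ P.Y0 := by exact_mod_cast hY0
  have hlow : ∀ᵐ ω ∂P.μ, ∀ n, ((P.S n : ℕ) : ℝ)⁻¹ ≤ σ + τ * P.x n ω := by
    filter_upwards [P.X_low] with ω hω n
    have hS := P.S_pos hX0 n
    have h := hω n
    rw [P.X_eq hX0] at h
    rw [inv_le_iff_one_le_mul₀ (by linarith)]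
    rcases hστ with ⟨rfl, rfl⟩ | ⟨rfl, rfl⟩ <;> nlinarith [h.1, h.2]
  have hgx : ∀ n, P.Good n (fun ω => max (σ + τ * P.x n ω) ((P.S n : ℕ) : ℝ)⁻¹) := fun n =>
    P.good_x n (f := fun z => max (σ + τ * z) ((P.S n : ℕ) : ℝ)⁻¹) (by fun_prop)
  refine P.criterion (fun ω => σ + τ * P.xi ω) ?_ 1 ?_
    (fun n ω => max (σ + τ * P.x n ω) ((P.S n : ℕ) : ℝ)⁻¹) hgx
    (fun n => ((P.S n : ℕ) : ℝ)⁻¹) ?_ (fun n ω => le_max_right _ _) 1 (1 + 2 * P.m) one_pos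
    (by positivity) ?_ ?_
  · exact stronglyMeasurable_const.add (stronglyMeasurable_const.mul P.xi_meas)
  · filter_upwards [P.xi_mem hlin hX0] with ω hω
    rw [abs_le]
    rcases hστ with ⟨rfl, rfl⟩ | ⟨rfl, rfl⟩ <;> constructor <;> linarith [hω.1, hω.2]
  · intro n
    have := P.S_pos hX0 n
    positivity
  · intro n w hw hw0
    rw [one_mul]
    refine le_of_eq_of_le (integral_congr_ae ?_) (P.mom1 hlin hX0 σ τ hw hw0)
    filter_upwards [hlow] with ω hω
    simp only [max_eq_left (hω n)]
  · intro n w hw hw0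
    refine (P.mom2 hlin hX0 σ τ hστ hw hw0).trans ?_
    rw [← integral_const_mul]
    refine integral_mono_ae ?_ ?_ ?_
    · exact (hw.mul (P.good_x n (f := fun z => (σ + τ * z) ^ 2
        + 2 * P.m * ((P.S n : ℕ) : ℝ)⁻¹ * (σ + τ * z)) (by fun_prop))).integrable
    · exact (hw.mul (P.good_x n (f := fun z => (max (σ + τ * z) ((P.S n : ℕ) : ℝ)⁻¹) ^ 2)
        (by fun_prop))).integrable |>.const_mul _
    · filter_upwards [hlow] with ω hω
      have h := hω n
      have hS := P.S_pos hX0 n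
      have hi : 0 < ((P.S n : ℕ) : ℝ)⁻¹ := by positivity
      simp only [max_eq_left h]
      rw [mul_left_comm]
      refine mul_le_mul_of_nonneg_left ?_ (hw0 ω)
      have : ((P.S n : ℕ) : ℝ)⁻¹ * (σ + τ * P.x n ω) ≤ (σ + τ * P.x n ω) ^ 2 := by nlinarith
      nlinarith

lemma intr_low {r x i : ℝ} (hr0 : 0 < r) (hr1 : r < 1) (hx0 : 0 ≤ x) (hx1 : x ≤ 1)
    (hi0 : 0 < i) (hi1 : i ≤ 1) :
    (r * (1 - r)) ^ 2 / 16 * ((x - r) ^ 2 + i) ≤ (x - r) ^ 2 + 8⁻¹ * i * (x * (1 - x)) := by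
  have hρ : 0 < r * (1 - r) := mul_pos hr0 (by linarith)
  have hρ1 : r * (1 - r) ≤ 1 := by nlinarith
  have hρ2 : (r * (1 - r)) ^ 2 ≤ r * (1 - r) := by nlinarith
  have hxx : 0 ≤ x * (1 - x) := mul_nonneg hx0 (by linarith)
  have hz := sq_nonneg (x - r)
  have hA : (r * (1 - r)) ^ 2 * (x - r) ^ 2 ≤ 1 * (x - r) ^ 2 :=
    mul_le_mul_of_nonneg_right (by linarith) hz
  by_cases h : |x - r| ≤ r * (1 - r) / 2
  · have h1 : r * (1 - r) / 2 ≤ x * (1 - x) := by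
      have : |x * (1 - x) - r * (1 - r)| ≤ |x - r| := by
        rw [show x * (1 - x) - r * (1 - r) = (x - r) * (1 - x - r) by ring, abs_mul]
        exact mul_le_of_le_one_right (abs_nonneg _) (abs_le.2 ⟨by linarith, by linarith⟩)
      linarith [(abs_le.1 (this.trans h)).1]
    have h2 : i * (r * (1 - r) / 2) ≤ i * (x * (1 - x)) := mul_le_mul_of_nonneg_left h1 hi0.le
    have h3 : i * (r * (1 - r)) ^ 2 ≤ i * (r * (1 - r)) := mul_le_mul_of_nonneg_left hρ2 hi0.le
    linarith
  · push Not at h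
    have h1 : (r * (1 - r) / 2) ^ 2 ≤ (x - r) ^ 2 := by
      rw [← sq_abs (x - r)]
      exact pow_le_pow_left₀ (by linarith) h.le 2
    have h2 : i * (r * (1 - r)) ^ 2 ≤ 1 * (r * (1 - r)) ^ 2 :=
      mul_le_mul_of_nonneg_right hi1 (sq_nonneg _)
    have h3 : 0 ≤ i * (x * (1 - x)) := mul_nonneg hi0.le hxx
    linarith

lemma intr (hlin : ∀ k ≤ P.m, P.p k = (k : ℝ) / P.m) (hX0 : 0 < P.X0)
    (r : ℝ) (hr0 : 0 < r) (hr1 : r < 1) :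
    ∀ᵐ ω ∂P.μ, (P.xi ω - r) ^ 2 ≠ 0 := by
  have hm1 : (1 : ℝ) ≤ P.m := by exact_mod_cast P.hm
  have hρ : 0 < r * (1 - r) := mul_pos hr0 (by linarith)
  have hi0 : ∀ n, 0 < ((P.S n : ℕ) : ℝ)⁻¹ := fun n => by
    have := P.S_pos hX0 n
    positivity
  have hgx : ∀ n, P.Good n (fun ω => (P.x n ω - r) ^ 2 + ((P.S n : ℕ) : ℝ)⁻¹) := fun n =>
    P.good_x n (f := fun z => (z - r) ^ 2 + ((P.S n : ℕ) : ℝ)⁻¹) (by fun_prop)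
  refine P.criterion (fun ω => (P.xi ω - r) ^ 2) ?_ 1 ?_
    (fun n ω => (P.x n ω - r) ^ 2 + ((P.S n : ℕ) : ℝ)⁻¹) hgx
    (fun n => ((P.S n : ℕ) : ℝ)⁻¹) hi0 (fun n ω => ?_)
    ((r * (1 - r)) ^ 2 / 16) (5 * (P.m : ℝ) ^ 2) (by positivity)
    (by positivity) ?_ ?_
  · exact (P.xi_meas.sub stronglyMeasurable_const).pow 2
  · filter_upwards [P.xi_mem hlin hX0] with ω hω
    rw [abs_of_nonneg (sq_nonneg _)]
    nlinarith [hω.1, hω.2]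
  · have := sq_nonneg (P.x n ω - r)
    linarith
  · intro n w hw hw0
    refine le_trans ?_ (P.mom2low hlin hX0 r hw hw0)
    rw [← integral_const_mul]
    refine integral_mono ((hw.mul (hgx n)).integrable |>.const_mul _)
      ((hw.mul (P.good_x n (f := fun z => (z - r) ^ 2
        + 8⁻¹ * ((P.S n : ℕ) : ℝ)⁻¹ * (z * (1 - z))) (by fun_prop))).integrable) fun ω => ?_
    simp only
    rw [mul_left_comm]
    exact mul_le_mul_of_nonneg_left (intr_low hr0 hr1 (P.x_mem n ω).1 (P.x_mem n ω).2 (hi0 n)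
      (inv_le_one_of_one_le₀ (P.S_pos hX0 n))) (hw0 ω)
  · intro n w hw hw0
    have h4 := P.mom4 hlin hX0 r hw hw0
    simp only [← pow_mul]
    refine h4.trans ?_
    rw [← integral_const_mul]
    refine integral_mono ((hw.mul (P.good_x n (f := fun z => (z - r) ^ 4
        + 4 * P.m * ((P.S n : ℕ) : ℝ)⁻¹ * (z - r) ^ 2 + 5 * P.m ^ 2 * ((P.S n : ℕ) : ℝ)⁻¹ ^ 2)
        (by fun_prop))).integrable)
      ((hw.mul (P.good_x n (f := fun z => ((z - r) ^ 2 + ((P.S n : ℕ) : ℝ)⁻¹) ^ 2)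
        (by fun_prop))).integrable |>.const_mul _) fun ω => ?_
    simp only
    rw [mul_left_comm]
    refine mul_le_mul_of_nonneg_left ?_ (hw0 ω)
    have hi := hi0 n
    generalize ((P.S n : ℕ) : ℝ)⁻¹ = i at hi
    generalize P.x n ω - r = z
    have hmm : (1 : ℝ) ≤ (P.m : ℝ) ^ 2 := by nlinarith
    have hmm2 : (P.m : ℝ) ≤ (P.m : ℝ) ^ 2 := by nlinarith
    have a1 : 0 ≤ ((P.m : ℝ) ^ 2 - 1) * z ^ 4 := mul_nonneg (by linarith) (by positivity)
    have a2 : 0 ≤ ((P.m : ℝ) ^ 2 - P.m) * (i * z ^ 2) := mul_nonneg (by linarith) (by positivity)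
    have a3 : 0 ≤ (P.m : ℝ) ^ 2 * (i * z ^ 2) := by positivity
    have a4 : 0 ≤ (P.m : ℝ) ^ 2 * z ^ 4 := by positivity
    nlinarith

end PAProcess


/-- **Linear model, no atoms.** In the linear model (`p_k = k/m` for all `0 ≤ k ≤ m`) with
`X_0 > 0` and `Y_0 > 0`, the distribution of the almost sure limit `a = lim a_n` has no atoms:
for every `r ∈ [0,1]`, `P(a = r) = 0`. -/
theorem linear_model_limit_no_atoms
    {Ω : Type} [MeasurableSpace Ω] (P : PAProcess Ω)
    (hlin : ∀ k ≤ P.m, P.p k = (k : ℝ) / P.m)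
    (hX0 : 0 < P.X0) (hY0 : 0 < P.Y0)
    (L : Ω → ℝ)
    (hL : ∀ᵐ ω ∂P.μ, Tendsto (fun n => P.a n ω) atTop (nhds (L ω)))
    (r : ℝ) (hr : r ∈ Set.Icc (0 : ℝ) 1) :
    P.μ {ω | L ω = r} = 0 := by

  have hne : ∀ᵐ ω ∂P.μ, P.xi ω ≠ r := by
    rcases hr.1.eq_or_lt with h0 | h0
    · filter_upwards [P.bdry hlin hX0 hY0 0 1 (Or.inl ⟨rfl, rfl⟩)] with ω h h'
      apply h
      rw [h', ← h0]
      norm_num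
    rcases hr.2.eq_or_lt with h1 | h1
    · filter_upwards [P.bdry hlin hX0 hY0 1 (-1) (Or.inr ⟨rfl, rfl⟩)] with ω h h'
      apply h
      rw [h', h1]
      norm_num
    · filter_upwards [P.intr hlin hX0 r h0 h1] with ω h h'
      apply h
      rw [h']
      norm_num
  have hfin : ∀ᵐ ω ∂P.μ, ¬ (L ω = r) := by
    filter_upwards [hne, P.xi_eq_L hlin hX0 L hL] with ω h h'
    rwa [← h']
  simpa [ae_iff] using hfin
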